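/- For every ζ ∈ [0,π], one has cos((π−ζ)/3) = (√3/2)·₂F₁(−1/6, 1/6; 1/2; cos²ζ) − (cos ζ/6)·₂F₁(1/3, 2/3; 3/2; cos²ζ). -/

import Mathlib

/-- Pochhammer symbol `(a)_n = a (a+1) ⋯ (a+n-1)`. -/
noncomputable def pochh (a : ℝ) (n : ℕ) : ℝ := ∏ i ∈ Finset.range n, (a + i)

/-- Gauss hypergeometric series `₂F₁(a,b;c;x)`. -/
noncomputable def hyp2F1 (a b c x : ℝ) : ℝ :=
  ∑' n : ℕ, pochh a n * pochh b n / (pochh c n * Nat.factorial n) * x ^ n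

/-- Coefficients of the formal derivative of the power series `∑ c n * y ^ n`. -/
def derivCoeff (c : ℕ → ℝ) (n : ℕ) : ℝ := (n + 1) * c (n + 1)

/-- Absolute convergence of `∑ c n * y ^ n` on the open unit interval. -/
def SummableOnUnit (c : ℕ → ℝ) : Prop :=
  ∀ r : ℝ, 0 ≤ r → r < 1 → Summable fun n => |c n| * r ^ n

theorem SummableOnUnit.derivCoeff {c : ℕ → ℝ} (hc : SummableOnUnit c) :
    SummableOnUnit (derivCoeff c) := by
  intro r hr0 hr1
  obtain ⟨s, hrs, hs1⟩ := exists_between hr1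
  have hs0 : 0 < s := hr0.trans_lt hrs
  have hS := hc s hs0.le hs1
  have hq1 : r / s < 1 := (div_lt_one hs0).2 hrs
  have hq0 : 0 ≤ r / s := by positivity
  have hq : ‖r / s‖ < 1 := by rwa [Real.norm_of_nonneg hq0]
  have hgeom : Summable fun n : ℕ => ((n : ℝ) + 1) * (r / s) ^ n := by
    have h1 := summable_pow_mul_geometric_of_norm_lt_one 1 hq
    have h0 := summable_geometric_of_norm_lt_one hq
    refine (h1.add h0).congr fun n => ?_
    ring
  refine Summable.of_nonneg_of_le (fun n => by positivity) (fun n => ?_)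
    (hgeom.mul_left ((∑' n, |c n| * s ^ n) / s))
  have hle : |c (n + 1)| * s ^ (n + 1) ≤ ∑' n, |c n| * s ^ n :=
    hS.le_tsum (n + 1) fun j _ => by positivity
  have hpos : (0 : ℝ) ≤ (n : ℝ) + 1 := by positivity
  calc |_root_.derivCoeff c n| * r ^ n
      = (|c (n + 1)| * s ^ (n + 1)) / s * (((n : ℝ) + 1) * (r / s) ^ n) := by
        rw [_root_.derivCoeff, abs_mul, abs_of_nonneg hpos, div_pow]
        field_simp
        ring
    _ ≤ _ := by gcongr

theorem SummableOnUnit.summable {c : ℕ → ℝ} (hc : SummableOnUnit c) {y : ℝ} (hy : |y| < 1) :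
    Summable fun n => c n * y ^ n := by
  refine Summable.of_abs ((hc |y| (abs_nonneg y) hy).congr fun n => ?_)
  rw [abs_mul, abs_pow]

theorem SummableOnUnit.hasDerivAt {c : ℕ → ℝ} (hc : SummableOnUnit c) {y : ℝ} (hy : |y| < 1) :
    HasDerivAt (fun z => ∑' n, c n * z ^ n) (∑' n, _root_.derivCoeff c n * y ^ n) y := by
  obtain ⟨r, hyr, hr1⟩ := exists_between hy
  have hr0 : 0 < r := (abs_nonneg y).trans_lt hyr
  have hu : Summable fun n : ℕ => |c n| * (n * r ^ (n - 1)) := by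
    rw [← summable_nat_add_iff 1]
    refine (hc.derivCoeff r hr0.le hr1).congr fun n => ?_
    have hpos : (0 : ℝ) ≤ (n : ℝ) + 1 := by positivity
    rw [_root_.derivCoeff, abs_mul, abs_of_nonneg hpos]
    push_cast
    ring
  have hbound : ∀ (n : ℕ) (z : ℝ), z ∈ Metric.ball (0 : ℝ) r →
      ‖c n * (n * z ^ (n - 1))‖ ≤ |c n| * (n * r ^ (n - 1)) := by
    intro n z hz
    have hz' : |z| ≤ r := by simpa using (mem_ball_zero_iff.1 hz).le
    rw [norm_mul, norm_mul, norm_pow, Real.norm_eq_abs, Real.norm_eq_abs, Real.norm_eq_abs,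
      Nat.abs_cast]
    gcongr
  have hy' : y ∈ Metric.ball (0 : ℝ) r := by simpa using hyr
  have h := hasDerivAt_tsum_of_isPreconnected hu Metric.isOpen_ball
    (convex_ball (0 : ℝ) r).isPreconnected
    (fun n z _ => (hasDerivAt_pow n z).const_mul (c n)) hbound
    (Metric.mem_ball_self hr0) (hc.summable (by simp)) hy'
  refine h.congr_deriv ?_
  rw [(Summable.of_norm_bounded hu fun n => hbound n y hy').tsum_eq_zero_add]
  simp only [Nat.cast_zero, zero_mul, mul_zero, zero_add, Nat.add_sub_cancel]
  refine tsum_congr fun n => ?_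
  rw [_root_.derivCoeff]
  push_cast
  ring

theorem SummableOnUnit.mul_tsum_derivCoeff {c : ℕ → ℝ} (hc : SummableOnUnit c) {y : ℝ}
    (hy : |y| < 1) :
    HasSum (fun n : ℕ => n * c n * y ^ n) (y * ∑' n, _root_.derivCoeff c n * y ^ n) := by
  have h := (hc.derivCoeff.summable hy).hasSum.mul_left y
  rw [← hasSum_nat_add_iff' 1]
  simp only [Finset.range_one, Finset.sum_singleton, Nat.cast_zero, zero_mul, sub_zero]
  refine (congrArg (HasSum · _) (funext fun n => ?_)).mp h
  simp only [_root_.derivCoeff]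
  push_cast
  ring

/-- The recurrence of the coefficients turns into the differential equation
`(1 - y²) f'' - y f' + a² f = 0`. -/
theorem tsum_chebyshev_ode {c : ℕ → ℝ} {a : ℝ} (hc : SummableOnUnit c)
    (hrec : ∀ n : ℕ, ((n : ℝ) + 1) * (n + 2) * c (n + 2) = ((n : ℝ) ^ 2 - a ^ 2) * c n)
    {y : ℝ} (hy : |y| < 1) :
    (1 - y ^ 2) * ∑' n, derivCoeff (derivCoeff c) n * y ^ n =
      y * ∑' n, derivCoeff c n * y ^ n - a ^ 2 * ∑' n, c n * y ^ n := by
  have h0 := (hc.summable hy).hasSum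
  have h1 := hc.mul_tsum_derivCoeff hy
  have h2 := (hc.derivCoeff.derivCoeff.summable hy).hasSum
  have h3 : HasSum (fun n : ℕ => (n : ℝ) * (n - 1) * c n * y ^ n)
      (y ^ 2 * ∑' n, derivCoeff (derivCoeff c) n * y ^ n) := by
    have h := (hc.derivCoeff.mul_tsum_derivCoeff hy).mul_left y
    rw [← hasSum_nat_add_iff' 1]
    simp only [Finset.range_one, Finset.sum_singleton, Nat.cast_zero, zero_mul, sub_zero]
    rw [pow_two, mul_assoc]
    refine (congrArg (HasSum · _) (funext fun n => ?_)).mp h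
    simp only [derivCoeff]
    push_cast
    ring
  have h := ((h2.sub h3).sub h1).add (h0.mul_left (a ^ 2))
  have hz : (fun n : ℕ => derivCoeff (derivCoeff c) n * y ^ n - (n : ℝ) * (n - 1) * c n * y ^ n
      - n * c n * y ^ n + a ^ 2 * (c n * y ^ n)) = fun _ => 0 := by
    funext n
    have := hrec n
    simp only [derivCoeff]
    push_cast
    linear_combination y ^ n * this
  rw [hz] at h
  linear_combination h.unique hasSum_zero

/-- A solution of `g'' = -a² g` on an open interval around `0` is trigonometric. -/
theorem eq_cos_add_sin_of_hasDerivAt {g g' : ℝ → ℝ} {a b : ℝ} (ha : a ≠ 0) (hb : 0 < b)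
    (hg : ∀ t ∈ Set.Ioo (-b) b, HasDerivAt g (g' t) t)
    (hg' : ∀ t ∈ Set.Ioo (-b) b, HasDerivAt g' (-a ^ 2 * g t) t) :
    ∀ t ∈ Set.Ioo (-b) b, g t = g 0 * Real.cos (a * t) + g' 0 / a * Real.sin (a * t) := by
  have hlin : ∀ t : ℝ, HasDerivAt (fun t => a * t) a t := fun t => by
    simpa using (hasDerivAt_id t).const_mul a
  have hconst : ∀ F : ℝ → ℝ, (∀ t ∈ Set.Ioo (-b) b, HasDerivAt F 0 t) →
      ∀ t ∈ Set.Ioo (-b) b, F t = F 0 := by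
    intro F hF t ht
    exact isOpen_Ioo.is_const_of_deriv_eq_zero isPreconnected_Ioo
      (fun s hs => (hF s hs).differentiableAt.differentiableWithinAt)
      (fun s hs => (hF s hs).deriv) ht ⟨by linarith, hb⟩
  intro t ht
  have hA := hconst (fun t => a * g t * Real.cos (a * t) - g' t * Real.sin (a * t))
    (fun s hs => by
      refine ((((hg s hs).const_mul a).mul (hlin s).cos).sub
        ((hg' s hs).mul (hlin s).sin)).congr_deriv ?_
      ring) t ht
  have hB := hconst (fun t => a * g t * Real.sin (a * t) + g' t * Real.cos (a * t))
    (fun s hs => by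
      refine ((((hg s hs).const_mul a).mul (hlin s).sin).add
        ((hg' s hs).mul (hlin s).cos)).congr_deriv ?_
      ring) t ht
  simp only [mul_zero, Real.cos_zero, Real.sin_zero, mul_one, sub_zero, zero_add] at hA hB
  field_simp
  linear_combination Real.cos (a * t) * hA + Real.sin (a * t) * hB
    - a * g t * Real.sin_sq_add_cos_sq (a * t)

theorem summable_abs_of_chebyshev_recurrence {c : ℕ → ℝ} {a : ℝ} (ha : a ^ 2 ≤ 1)
    (hrec : ∀ n : ℕ, ((n : ℝ) + 1) * (n + 2) * c (n + 2) = ((n : ℝ) ^ 2 - a ^ 2) * c n) :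
    Summable fun n => |c n| := by
  have hstep : ∀ n : ℕ, |c (n + 1)| ≤
      2 * (((n : ℝ) + 1) * |c (n + 1)| - (n + 3) * |c (n + 3)|) := by
    intro n
    have h := congrArg abs (hrec (n + 1))
    have hn : (0 : ℝ) ≤ n := n.cast_nonneg
    have hp : (0 : ℝ) ≤ ((n : ℝ) + 1 + 1) * (n + 1 + 2) := by positivity
    have hq : (0 : ℝ) ≤ ((n : ℝ) + 1) ^ 2 - a ^ 2 := by nlinarith
    push_cast at h
    rw [abs_mul, abs_of_nonneg hp, abs_mul, abs_of_nonneg hq] at h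
    have hu := abs_nonneg (c (n + 1))
    have h' : ((n : ℝ) + 2) * (((n : ℝ) + 3) * |c (n + 3)|) =
        (((n : ℝ) + 1) ^ 2 - a ^ 2) * |c (n + 1)| := by
      rw [← h]
      ring
    have hpos : (0 : ℝ) < n + 2 := by positivity
    refine le_of_mul_le_mul_left ?_ hpos
    have hmul : 0 ≤ ((n : ℝ) + 2 * a ^ 2) * |c (n + 1)| := by positivity
    nlinarith
  rw [← summable_nat_add_iff 1]
  refine summable_of_sum_range_le (c := 2 * (|c 1| + 2 * |c 2|)) (fun n => abs_nonneg _) fun N => ?_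
  have hsum : ∑ n ∈ Finset.range N, |c (n + 1)| ≤ 2 * (|c 1| + 2 * |c 2|)
      - 2 * (((N : ℝ) + 1) * |c (N + 1)| + (N + 2) * |c (N + 2)|) := by
    induction N with
    | zero => simp
    | succ N ih =>
      rw [Finset.sum_range_succ]
      have := hstep N
      push_cast
      rw [show N + 1 + 1 = N + 2 by ring, show N + 1 + 2 = N + 3 by ring]
      linarith
  have : 0 ≤ 2 * (((N : ℝ) + 1) * |c (N + 1)| + (N + 2) * |c (N + 2)|) := by positivity
  linarith

theorem tsum_mul_sin_pow_of_chebyshev_recurrence {c : ℕ → ℝ} {a : ℝ} (ha0 : a ≠ 0)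
    (ha : a ^ 2 ≤ 1)
    (hrec : ∀ n : ℕ, ((n : ℝ) + 1) * (n + 2) * c (n + 2) = ((n : ℝ) ^ 2 - a ^ 2) * c n)
    {t : ℝ} (ht : t ∈ Set.Icc (-(Real.pi / 2)) (Real.pi / 2)) :
    ∑' n, c n * Real.sin t ^ n = c 0 * Real.cos (a * t) + c 1 / a * Real.sin (a * t) := by
  have habs := summable_abs_of_chebyshev_recurrence ha hrec
  have hc : SummableOnUnit c := fun r hr0 hr1 =>
    Summable.of_nonneg_of_le (fun n => by positivity)
      (fun n => mul_le_of_le_one_right (abs_nonneg _) (pow_le_one₀ hr0 hr1.le)) habs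
  have hsin : ∀ s ∈ Set.Ioo (-(Real.pi / 2)) (Real.pi / 2), |Real.sin s| < 1 := by
    intro s hs
    have h := Real.cos_pos_of_mem_Ioo hs
    rw [← sq_lt_one_iff_abs_lt_one]
    nlinarith [Real.sin_sq_add_cos_sq s]
  have hzero : ∀ d : ℕ → ℝ, ∑' n, d n * (0 : ℝ) ^ n = d 0 := by
    intro d
    rw [tsum_eq_single 0 fun n hn => by simp [hn]]
    simp
  have hopen := eq_cos_add_sin_of_hasDerivAt (g := fun s => ∑' n, c n * Real.sin s ^ n)
    (g' := fun s => (∑' n, derivCoeff c n * Real.sin s ^ n) * Real.cos s) ha0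
    (half_pos Real.pi_pos)
    (fun s hs => (hc.hasDerivAt (hsin s hs)).comp s (Real.hasDerivAt_sin s))
    (fun s hs => by
      have h := ((hc.derivCoeff.hasDerivAt (hsin s hs)).comp s (Real.hasDerivAt_sin s)).mul
        (Real.hasDerivAt_cos s)
      refine h.congr_deriv ?_
      have hode := tsum_chebyshev_ode hc hrec (hsin s hs)
      rw [← Real.cos_sq'] at hode
      simp only [Function.comp_apply]
      linear_combination hode)
  simp only [Real.sin_zero, Real.cos_zero, hzero, mul_one] at hopen
  have hd : derivCoeff c 0 = c 1 := by simp [derivCoeff]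
  rw [hd] at hopen
  have hcont : Continuous fun s => ∑' n, c n * Real.sin s ^ n := by
    refine continuous_tsum (fun n => by fun_prop) habs fun n s => ?_
    rw [norm_mul, norm_pow, Real.norm_eq_abs, Real.norm_eq_abs]
    exact mul_le_of_le_one_right (abs_nonneg _) (pow_le_one₀ (abs_nonneg _) (Real.abs_sin_le_one s))
  have hclosure := Set.EqOn.closure (s := Set.Ioo (-(Real.pi / 2)) (Real.pi / 2)) hopen hcont
    (by fun_prop)
  rw [closure_Ioo (by linarith [Real.pi_pos])] at hclosure
  exact hclosure ht

/-- The `n`-th coefficient of the Gauss hypergeometric series. -/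
noncomputable def hypCoeff (a b c : ℝ) (n : ℕ) : ℝ :=
  pochh a n * pochh b n / (pochh c n * Nat.factorial n)

theorem hypCoeff_succ {a b c : ℝ} (hc : 0 < c) (n : ℕ) :
    (c + n) * (n + 1) * hypCoeff a b c (n + 1) = (a + n) * (b + n) * hypCoeff a b c n := by
  have hp : pochh c n ≠ 0 :=
    (Finset.prod_pos fun i _ => by positivity : 0 < pochh c n).ne'
  have hcn : c + n ≠ 0 := by positivity
  have hf : (Nat.factorial n : ℝ) ≠ 0 := by positivity
  have hn : (n : ℝ) + 1 ≠ 0 := by positivity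
  have hs : ∀ x : ℝ, pochh x (n + 1) = pochh x n * (x + n) := fun x => Finset.prod_range_succ _ _
  simp only [hypCoeff, hs, Nat.factorial_succ]
  push_cast
  field_simp

theorem hypCoeff_zero (a b c : ℝ) : hypCoeff a b c 0 = 1 := by
  simp [hypCoeff, pochh]

/-- Power series coefficients of `y ↦ cos (π / 6 + arcsin y / 3)`. -/
noncomputable def cosThirdCoeff (n : ℕ) : ℝ :=
  if Even n then Real.sqrt 3 / 2 * hypCoeff (-(1 / 6)) (1 / 6) (1 / 2) (n / 2)
  else -(1 / 6) * hypCoeff (1 / 3) (2 / 3) (3 / 2) (n / 2)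

theorem cosThirdCoeff_even (k : ℕ) :
    cosThirdCoeff (2 * k) = Real.sqrt 3 / 2 * hypCoeff (-(1 / 6)) (1 / 6) (1 / 2) k := by
  simp [cosThirdCoeff]

theorem cosThirdCoeff_odd (k : ℕ) :
    cosThirdCoeff (2 * k + 1) = -(1 / 6) * hypCoeff (1 / 3) (2 / 3) (3 / 2) k := by
  rw [cosThirdCoeff, if_neg (by simp), show (2 * k + 1) / 2 = k by omega]

theorem cosThirdCoeff_recurrence (n : ℕ) :
    ((n : ℝ) + 1) * (n + 2) * cosThirdCoeff (n + 2) =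
      ((n : ℝ) ^ 2 - (1 / 3) ^ 2) * cosThirdCoeff n := by
  obtain ⟨k, rfl | rfl⟩ := Nat.even_or_odd' n
  · rw [show 2 * k + 2 = 2 * (k + 1) by ring, cosThirdCoeff_even, cosThirdCoeff_even]
    have h := hypCoeff_succ (a := -(1 / 6)) (b := 1 / 6) (c := 1 / 2) (by norm_num) k
    push_cast
    linear_combination 2 * Real.sqrt 3 * h
  · rw [show 2 * k + 1 + 2 = 2 * (k + 1) + 1 by ring, cosThirdCoeff_odd, cosThirdCoeff_odd]
    have h := hypCoeff_succ (a := 1 / 3) (b := 2 / 3) (c := 3 / 2) (by norm_num) k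
    push_cast
    linear_combination -(2 / 3) * h

theorem tsum_cosThirdCoeff {y : ℝ} (hy : |y| ≤ 1) :
    ∑' n, cosThirdCoeff n * y ^ n =
      Real.sqrt 3 / 2 * hyp2F1 (-(1 / 6)) (1 / 6) (1 / 2) (y ^ 2) -
        y / 6 * hyp2F1 (1 / 3) (2 / 3) (3 / 2) (y ^ 2) := by
  have hs : Summable fun n => cosThirdCoeff n * y ^ n := by
    refine Summable.of_norm_bounded
      (summable_abs_of_chebyshev_recurrence (a := 1 / 3) (by norm_num) cosThirdCoeff_recurrence) fun n => ?_
    rw [norm_mul, norm_pow, Real.norm_eq_abs, Real.norm_eq_abs]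
    exact mul_le_of_le_one_right (abs_nonneg _) (pow_le_one₀ (abs_nonneg _) hy)
  have he : Function.Injective fun k : ℕ => 2 * k := fun i j h => by simpa using h
  have ho : Function.Injective fun k : ℕ => 2 * k + 1 := fun i j h => by simpa using h
  have hse : Summable fun k => cosThirdCoeff (2 * k) * y ^ (2 * k) := hs.comp_injective he
  have hso : Summable fun k => cosThirdCoeff (2 * k + 1) * y ^ (2 * k + 1) := hs.comp_injective ho
  rw [← tsum_even_add_odd (f := fun n => cosThirdCoeff n * y ^ n) hse hso, hyp2F1, hyp2F1,
    ← tsum_mul_left, ← tsum_mul_left, sub_eq_add_neg, ← tsum_neg]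
  congr 1
  · refine tsum_congr fun k => ?_
    rw [cosThirdCoeff_even, hypCoeff, pow_mul]
    ring
  · refine tsum_congr fun k => ?_
    rw [cosThirdCoeff_odd, hypCoeff, pow_succ, pow_mul]
    ring

theorem stmt15 (ζ : ℝ) (hζ : ζ ∈ Set.Icc (0 : ℝ) Real.pi) :
    Real.cos ((Real.pi - ζ) / 3) =
      Real.sqrt 3 / 2 * hyp2F1 (-(1 / 6)) (1 / 6) (1 / 2) (Real.cos ζ ^ 2) -
        Real.cos ζ / 6 * hyp2F1 (1 / 3) (2 / 3) (3 / 2) (Real.cos ζ ^ 2) := by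
  have ht : Real.pi / 2 - ζ ∈ Set.Icc (-(Real.pi / 2)) (Real.pi / 2) :=
    ⟨by linarith [hζ.2], by linarith [hζ.1]⟩
  have h := tsum_mul_sin_pow_of_chebyshev_recurrence (a := 1 / 3) (by norm_num) (by norm_num)
    cosThirdCoeff_recurrence ht
  rw [Real.sin_pi_div_two_sub, tsum_cosThirdCoeff (Real.abs_cos_le_one ζ)] at h
  have h0 : cosThirdCoeff 0 = Real.sqrt 3 / 2 := by
    simpa [hypCoeff_zero] using cosThirdCoeff_even 0
  have h1 : cosThirdCoeff 1 = -(1 / 6) := by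
    simpa [hypCoeff_zero] using cosThirdCoeff_odd 0
  rw [h, h0, h1, show (Real.pi - ζ) / 3 = Real.pi / 6 + 1 / 3 * (Real.pi / 2 - ζ) by ring,
    Real.cos_add, Real.cos_pi_div_six, Real.sin_pi_div_six]
  ring
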